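/- Theorem 2, order-scaled upwind case (linear growth of the staggered DG operator bound in the polynomial degrees): With the notation of the context, suppose β = β̂/(q_u·c) and τ = c·τ̂/(q_v+1) for fixed dimensionless constants β̂, τ̂ ≥ 0. Then for all primary broken functions w, φ of degree q_u − 1 and dual broken functions v, ψ of degree q_v, B_c(w,v;φ,ψ) ≤ (c/h) · [ ((8√3+4)/3)·(q_u + q_v − 1) + (128/(√3·π))·√(q_u·(q_v+1)) + 4·max{ β̂·q_u, τ̂·(q_v+1) } ] · (c²‖w‖² + ‖v‖²)^{1/2} · (c²‖φ‖² + ‖ψ‖²)^{1/2}, a bound depending only linearly on q_u and q_v. -/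

import Mathlib

open Polynomial

/-- Squared L² norm of a broken (piecewise polynomial) function on a periodic grid
of `N` elements each of width `h`, in local coordinates `s ∈ [0,h]`. -/
noncomputable def brokenNormSq (N : ℕ) [NeZero N] (h : ℝ)
    (p : ZMod N → Polynomial ℝ) : ℝ :=
  ∑ j : ZMod N, ∫ s in (0:ℝ)..h, (p j).eval s ^ 2

/-- The numerical flux `H_j` of the staggered energy-based DG method, located at
the primary node `jh`, interior to the dual element `J_j`. -/
noncomputable def HfluxS (N : ℕ) [NeZero N] (h c β : ℝ)
    (w v : ZMod N → Polynomial ℝ) (j : ZMod N) : ℝ :=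
  (v j).eval (h / 2) - β * c ^ 2 * ((w (j - 1)).eval h - (w j).eval 0)

/-- The numerical flux `G_j` of the staggered energy-based DG method, located at
the primary element center `(j+1/2)h`, the shared boundary of `J_j` and `J_{j+1}`. -/
noncomputable def GfluxS (N : ℕ) [NeZero N] (h c τ : ℝ)
    (w v : ZMod N → Polynomial ℝ) (j : ZMod N) : ℝ :=
  (w j).eval (h / 2) - τ / c ^ 2 * ((v j).eval h - (v (j + 1)).eval 0)

/-- The staggered energy-based DG bilinear form `B_c(w,v;φ,ψ)`. -/
noncomputable def BformS (N : ℕ) [NeZero N] (h c β τ : ℝ)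
    (w v φ ψ : ZMod N → Polynomial ℝ) : ℝ :=
  -(c ^ 2) * (∑ j : ZMod N,
      ((∫ s in (0:ℝ)..(h / 2), (derivative (φ j)).eval s * (v j).eval (s + h / 2))
        + (∫ s in (h / 2)..h, (derivative (φ j)).eval s * (v (j + 1)).eval (s - h / 2))
        - (φ j).eval h * HfluxS N h c β w v (j + 1)
        + (φ j).eval 0 * HfluxS N h c β w v j))
    - c ^ 2 * (∑ j : ZMod N,
      ((∫ s in (0:ℝ)..(h / 2), (derivative (ψ j)).eval s * (w (j - 1)).eval (s + h / 2))
        + (∫ s in (h / 2)..h, (derivative (ψ j)).eval s * (w j).eval (s - h / 2))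
        - (ψ j).eval h * GfluxS N h c τ w v j
        + (ψ j).eval 0 * GfluxS N h c τ w v (j - 1)))

noncomputable def ipI (h : ℝ) (p : ℝ[X]) : ℝ := ∫ s in (0:ℝ)..h, p.eval s

theorem poly_ii (p : ℝ[X]) (a b : ℝ) :
    IntervalIntegrable (fun s => p.eval s) MeasureTheory.volume a b :=
  p.continuous.intervalIntegrable a b

theorem ipI_add (h : ℝ) (p q : ℝ[X]) : ipI h (p + q) = ipI h p + ipI h q := by
  unfold ipI
  simp only [eval_add]
  exact intervalIntegral.integral_add (poly_ii p _ _) (poly_ii q _ _)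

theorem ipI_C_mul (h a : ℝ) (p : ℝ[X]) : ipI h (C a * p) = a * ipI h p := by
  unfold ipI
  simp only [eval_mul, eval_C]
  exact intervalIntegral.integral_const_mul _ _

theorem ipI_neg (h : ℝ) (p : ℝ[X]) : ipI h (-p) = - ipI h p := by
  have := ipI_C_mul h (-1) p
  simpa using this

theorem ipI_sub (h : ℝ) (p q : ℝ[X]) : ipI h (p - q) = ipI h p - ipI h q := by
  rw [sub_eq_add_neg, ipI_add, ipI_neg]; ring

theorem ipI_deriv (h : ℝ) (p : ℝ[X]) : ipI h (derivative p) = p.eval h - p.eval 0 := by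
  unfold ipI
  exact intervalIntegral.integral_eq_sub_of_hasDerivAt (fun x _ => p.hasDerivAt x)
    (poly_ii _ _ _)

theorem ipI_sq_nonneg (h : ℝ) (hh : 0 < h) (p : ℝ[X]) : 0 ≤ ipI h (p * p) := by
  unfold ipI
  apply intervalIntegral.integral_nonneg hh.le
  intro x _
  rw [eval_mul]; exact mul_self_nonneg _

theorem ipI_sq_eq_zero (h : ℝ) (hh : 0 < h) (p : ℝ[X]) (h0 : ipI h (p * p) = 0) : p = 0 := by
  by_contra hp
  have hfin : (p.roots.toFinset : Set ℝ).Finite := Finset.finite_toSet _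
  have hinf : (Set.Ioo 0 h).Infinite := Set.Ioo_infinite hh
  obtain ⟨x, hx, hxr⟩ := (hinf.sdiff hfin).nonempty
  have hx0 : p.eval x ≠ 0 := by
    intro he
    apply hxr
    simp [hp, he]
  have : 0 < ipI h (p * p) := by
    unfold ipI
    apply intervalIntegral.integral_pos hh (p * p).continuous.continuousOn
    · intro y _; rw [eval_mul]; exact mul_self_nonneg _
    · refine ⟨x, ⟨hx.1.le, hx.2.le⟩, ?_⟩
      rw [eval_mul]; exact mul_self_pos.2 hx0
  linarith

/-- Orthogonal projection on polynomials of degree less than `n`. -/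
theorem exists_proj (h : ℝ) (hh : 0 < h) (n : ℕ) : ∀ p : ℝ[X], ∃ r : ℝ[X], r.degree < (n : WithBot ℕ) ∧
    ∀ q : ℝ[X], q.degree < (n : WithBot ℕ) → ipI h ((p - r) * q) = 0 := by
  induction n with
  | zero =>
    intro p
    refine ⟨0, by simp, ?_⟩
    intro q hq
    have : q = 0 := by simpa using hq
    subst this
    simp [ipI]
  | succ n ih =>
    intro p
    obtain ⟨rn, hrn, hon⟩ := ih (X ^ n)
    obtain ⟨rp, hrp, hop⟩ := ih p
    set e : ℝ[X] := X ^ n - rn with he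
    have hcn : e.coeff n = 1 := by
      have := (degree_lt_iff_coeff_zero _ _).1 hrn n le_rfl
      simp [he, this]
    have hed : e.degree < ((n+1 : ℕ) : WithBot ℕ) := by
      rw [degree_lt_iff_coeff_zero]
      intro m hm
      have := (degree_lt_iff_coeff_zero _ _).1 hrn m (by omega)
      have h2 : m ≠ n := by omega
      simp [he, this, coeff_X_pow, h2]
    have hne : e ≠ 0 := by
      intro h0; rw [h0] at hcn; simp at hcn
    have hpos : ipI h (e * e) ≠ 0 := fun h0 => hne (ipI_sq_eq_zero h hh e h0)
    set a := ipI h (p * e) / ipI h (e * e) with ha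
    have haa : a * ipI h (e * e) = ipI h (p * e) := by rw [ha]; field_simp
    have here : ipI h (rp * e) = 0 := by rw [mul_comm]; exact hon rp hrp
    refine ⟨rp + C a * e, ?_, ?_⟩
    · rw [degree_lt_iff_coeff_zero] at *
      intro m hm
      rw [coeff_add, coeff_C_mul, hed m hm, hrp m (by omega)]; simp
    · intro q hq
      have hq' : (q - C (q.coeff n) * e).degree < (n : WithBot ℕ) := by
        rw [degree_lt_iff_coeff_zero] at *
        intro m hm
        rw [coeff_sub, coeff_C_mul]
        rcases Nat.eq_or_lt_of_le hm with h1 | h1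
        · subst h1; rw [hcn]; ring
        · rw [hq m h1, hed m h1]; ring
      have h1 := hop _ hq'
      have h2 := hon _ hq'
      rw [mul_sub, ipI_sub] at h1 h2
      have e1 : (p - rp) * (C (q.coeff n) * e) = C (q.coeff n) * (p * e - rp * e) := by ring
      have e2 : e * (C (q.coeff n) * e) = C (q.coeff n) * (e * e) := by ring
      rw [e1, ipI_C_mul, ipI_sub, here] at h1
      rw [e2, ipI_C_mul] at h2
      have e3 : (p - (rp + C a * e)) * q = (p - rp) * q - C a * (e * q) := by ring
      rw [e3, ipI_sub, ipI_C_mul]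
      linear_combination h1 - a * h2 - (q.coeff n) * haa

/-- Decomposition used in the inductions. -/
theorem decomp (h : ℝ) (hh : 0 < h) (n : ℕ) (p : ℝ[X]) (hp : p.degree < ((n + 1 : ℕ) : WithBot ℕ)) :
    ∃ r e : ℝ[X], p = r + e ∧ r.degree < (n : WithBot ℕ) ∧ e.degree < ((n + 1 : ℕ) : WithBot ℕ) ∧
      ∀ q : ℝ[X], q.degree < (n : WithBot ℕ) → ipI h (e * q) = 0 := by
  obtain ⟨r, hr, ho⟩ := exists_proj h hh n p
  refine ⟨r, p - r, by ring, hr, ?_, ho⟩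
  rw [degree_lt_iff_coeff_zero] at *
  intro m hm
  rw [coeff_sub, hp m hm, hr m (by omega)]; ring

theorem norm_decomp (h : ℝ) (r e : ℝ[X]) (h0 : ipI h (e * r) = 0) :
    ipI h ((r + e) * (r + e)) = ipI h (r * r) + ipI h (e * e) := by
  have : (r + e) * (r + e) = r * r + C 2 * (e * r) + e * e := by
    rw [show (C 2 : ℝ[X]) = 2 from rfl]; ring
  rw [this, ipI_add, ipI_add, ipI_C_mul, h0]; ring

theorem trace_ortho (h x : ℝ) (n : ℕ) (e : ℝ[X]) (he : e.degree < ((n + 1 : ℕ) : WithBot ℕ))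
    (ho : ∀ q : ℝ[X], q.degree < (n : WithBot ℕ) → ipI h (e * q) = 0) :
    ipI h (derivative ((X - C x) * (e * e))) = (2 * n + 1) * ipI h (e * e) := by
  have hd : ((X - C x) * derivative e - C (n : ℝ) * e).degree < (n : WithBot ℕ) := by
    rw [degree_lt_iff_coeff_zero] at *
    intro m hm
    rw [sub_mul, coeff_sub, coeff_sub, coeff_C_mul, coeff_C_mul, coeff_derivative, he (m+1) (by omega)]
    rcases Nat.eq_or_lt_of_le hm with h1 | h1
    · subst h1
      cases n with
      | zero => simp
      | succ k => rw [coeff_X_mul, coeff_derivative]; push_cast; ring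
    · rw [he m h1]
      cases m with
      | zero => omega
      | succ k => rw [coeff_X_mul, coeff_derivative, he (k+1) h1]; ring
  have h1 := ho _ hd
  have e1 : derivative ((X - C x) * (e * e)) = e * e + C 2 * (e * ((X - C x) * derivative e - C (n : ℝ) * e)) + C (2 * (n : ℝ)) * (e * e) := by
    rw [C_mul, show (C 2 : ℝ[X]) = 2 from rfl]
    simp only [derivative_mul, derivative_sub, derivative_X, derivative_C]
    ring
  rw [e1, ipI_add, ipI_add, ipI_C_mul, ipI_C_mul, h1]; ring

theorem trace_aux (h : ℝ) (hh : 0 < h) (x y : ℝ) (hxy : ∀ p : ℝ[X], ipI h (derivative ((X - C x) * (p * p))) = h * (p.eval y) ^ 2) (n : ℕ) :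
    ∀ p : ℝ[X], p.degree < (n : WithBot ℕ) → h * (p.eval y) ^ 2 ≤ n ^ 2 * ipI h (p * p) := by
  induction n with
  | zero =>
    intro p hp
    have : p = 0 := by simpa using hp
    subst this; simp
  | succ n ih =>
    intro p hp
    obtain ⟨r, e, rfl, hr, he, ho⟩ := decomp h hh n p hp
    have h1 := ih r hr
    have h2 := trace_ortho h x n e he ho
    rw [hxy] at h2
    rw [norm_decomp h r e (ho r hr), eval_add]
    have hR := ipI_sq_nonneg h hh r
    have hE := ipI_sq_nonneg h hh e
    set R := ipI h (r * r)
    set E := ipI h (e * e)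
    set α := r.eval y
    set β := e.eval y
    push_cast
    rcases Nat.eq_zero_or_pos n with h0 | h0
    · subst h0
      have hr0 : r = 0 := by simpa using hr
      have : α = 0 := by simp [α, hr0]
      rw [this]; push_cast at *; nlinarith
    · have hn : (0:ℝ) < n := by exact_mod_cast h0
      -- (α+β)² ≤ α²(1+k)+β²(1+1/k), k = (2n+1)/n²
      have key : (α + β) ^ 2 ≤ α ^ 2 * ((n + 1) ^ 2 / n ^ 2) + β ^ 2 * ((n + 1) ^ 2 / (2 * n + 1)) := by
        have : α ^ 2 * ((n + 1) ^ 2 / n ^ 2) + β ^ 2 * ((n + 1) ^ 2 / (2 * n + 1)) - (α + β) ^ 2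
            = ((2 * n + 1) * α - n ^ 2 * β) ^ 2 / (n ^ 2 * (2 * n + 1)) := by
          field_simp; ring
        have h3 : 0 ≤ ((2 * n + 1) * α - n ^ 2 * β) ^ 2 / (n ^ 2 * (2 * (n:ℝ) + 1)) := by positivity
        linarith
      calc h * (α + β) ^ 2 ≤ h * (α ^ 2 * ((n + 1) ^ 2 / n ^ 2) + β ^ 2 * ((n + 1) ^ 2 / (2 * n + 1))) :=
            mul_le_mul_of_nonneg_left key hh.le
        _ = (h * α ^ 2) * ((n + 1) ^ 2 / n ^ 2) + (h * β ^ 2) * ((n + 1) ^ 2 / (2 * n + 1)) := by ring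
        _ ≤ (n ^ 2 * R) * ((n + 1) ^ 2 / n ^ 2) + ((2 * n + 1) * E) * ((n + 1) ^ 2 / (2 * n + 1)) := by
            rw [h2]; gcongr
        _ = (n + 1) ^ 2 * (R + E) := by field_simp

theorem trace_right (h : ℝ) (hh : 0 < h) (n : ℕ) (p : ℝ[X]) (hp : p.degree < (n : WithBot ℕ)) :
    h * (p.eval h) ^ 2 ≤ n ^ 2 * ipI h (p * p) := by
  refine trace_aux h hh 0 h ?_ n p hp
  intro p; rw [ipI_deriv]; simp only [eval_mul, eval_sub, eval_X, eval_C]; ring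

theorem trace_left (h : ℝ) (hh : 0 < h) (n : ℕ) (p : ℝ[X]) (hp : p.degree < (n : WithBot ℕ)) :
    h * (p.eval 0) ^ 2 ≤ n ^ 2 * ipI h (p * p) := by
  refine trace_aux h hh h 0 ?_ n p hp
  intro p; rw [ipI_deriv]; simp only [eval_mul, eval_sub, eval_X, eval_C]; ring

/-- The Legendre operator. -/
noncomputable def legL (h : ℝ) (p : ℝ[X]) : ℝ[X] := derivative ((X ^ 2 - C h * X) * derivative p)

theorem legL_coeff (h : ℝ) (p : ℝ[X]) (m : ℕ) :
    (legL h p).coeff m = m * (m + 1) * p.coeff m - h * (m + 1) ^ 2 * p.coeff (m + 1) := by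
  unfold legL
  rw [coeff_derivative, sub_mul, coeff_sub, mul_assoc, coeff_C_mul, coeff_X_mul, coeff_derivative,
    pow_two, mul_assoc, coeff_X_mul]
  cases m with
  | zero => simp
  | succ k => rw [coeff_X_mul, coeff_derivative]; push_cast; ring

theorem legL_ibp (h : ℝ) (p q : ℝ[X]) :
    ipI h (legL h p * q) = ipI h ((C h * X - X ^ 2) * (derivative p * derivative q)) := by
  have h1 := ipI_deriv h ((X ^ 2 - C h * X) * derivative p * q)
  rw [derivative_mul, ipI_add] at h1
  have h2 : (X ^ 2 - C h * X) * derivative p * derivative q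
      = -((C h * X - X ^ 2) * (derivative p * derivative q)) := by ring
  rw [h2, ipI_neg] at h1
  simp only [eval_mul, eval_sub, eval_X, eval_C, eval_pow] at h1
  unfold legL
  linear_combination h1

theorem legL_bound (h : ℝ) (hh : 0 < h) (n : ℕ) :
    ∀ p : ℝ[X], p.degree < (n : WithBot ℕ) → ipI h (legL h p * p) ≤ n ^ 2 * ipI h (p * p) := by
  induction n with
  | zero =>
    intro p hp
    have : p = 0 := by simpa using hp
    subst this; simp [legL, ipI]
  | succ n ih =>
    intro p hp
    obtain ⟨r, e, rfl, hr, he, ho⟩ := decomp h hh n p hp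
    have h1 := ih r hr
    rw [norm_decomp h r e (ho r hr)]
    have hR := ipI_sq_nonneg h hh r
    have hE := ipI_sq_nonneg h hh e
    have hLr : ipI h (e * legL h r) = 0 := by
      apply ho
      rw [degree_lt_iff_coeff_zero] at *
      intro m hm
      rw [legL_coeff, hr m hm, hr (m+1) (by omega)]; ring
    have hLe : ipI h (e * (legL h e - C ((n:ℝ) * (n + 1)) * e)) = 0 := by
      apply ho
      rw [degree_lt_iff_coeff_zero] at *
      intro m hm
      rw [coeff_sub, coeff_C_mul, legL_coeff, he (m+1) (by omega)]
      rcases Nat.eq_or_lt_of_le hm with h1 | h1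
      · subst h1; ring
      · rw [he m h1]; ring
    have hsym : ipI h (legL h e * r) = ipI h (legL h r * e) := by
      rw [legL_ibp, legL_ibp, mul_comm (derivative e)]
    have e1 : legL h (r + e) * (r + e) = legL h r * r + e * legL h r + legL h e * r
       + (e * (legL h e - C ((n:ℝ) * (n + 1)) * e) + C ((n:ℝ) * (n + 1)) * (e * e)) := by
      have : legL h (r + e) = legL h r + legL h e := by
        unfold legL; rw [derivative_add, mul_add, derivative_add]
      rw [this]; ring
    rw [e1, ipI_add, ipI_add, ipI_add, ipI_add, ipI_C_mul, hLe, hLr, hsym, mul_comm, mul_comm (legL h r) e, hLr]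
    rw [mul_comm r] 
    push_cast
    have hn : (0:ℝ) ≤ n := Nat.cast_nonneg n
    nlinarith [mul_nonneg hn hR, mul_nonneg hn hE]

theorem ipI_sub_le (h : ℝ) (p : ℝ[X]) (α β : ℝ) (h0 : 0 ≤ α) (hαβ : α ≤ β) (hβ : β ≤ h)
    (hp : ∀ s, 0 ≤ s → s ≤ h → 0 ≤ p.eval s) :
    ∫ s in α..β, p.eval s ≤ ipI h p := by
  unfold ipI
  apply intervalIntegral.integral_mono_interval h0 hαβ hβ _ (poly_ii _ _ _)
  rw [Filter.EventuallyLE, MeasureTheory.ae_restrict_iff' measurableSet_Ioc]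
  exact Filter.Eventually.of_forall (fun s hs => hp s hs.1.le hs.2)

theorem sq_sub_le (h : ℝ) (p : ℝ[X]) (α β : ℝ) (h0 : 0 ≤ α) (hαβ : α ≤ β) (hβ : β ≤ h) :
    ∫ s in α..β, p.eval s ^ 2 ≤ ipI h (p * p) := by
  have := ipI_sub_le h (p * p) α β h0 hαβ hβ (fun s _ _ => by rw [eval_mul]; exact mul_self_nonneg _)
  simp only [eval_mul, ← pow_two (eval _ _)] at this
  exact this

theorem deriv_mid (h : ℝ) (hh : 0 < h) (n : ℕ) (p : ℝ[X]) (hp : p.degree < (n : WithBot ℕ))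
    (α β : ℝ) (hα : h / 4 ≤ α) (hαβ : α ≤ β) (hβ : β ≤ 3 * h / 4) :
    ∫ s in α..β, (derivative p).eval s ^ 2 ≤ (7 * n / (3 * h)) ^ 2 * ipI h (p * p) := by
  have h1 := legL_bound h hh n p hp
  rw [legL_ibp] at h1
  have h2 := ipI_sub_le h ((C h * X - X ^ 2) * (derivative p * derivative p)) α β (by linarith) hαβ
    (by linarith) (by
      intro s h0 h1
      simp only [eval_mul, eval_sub, eval_X, eval_C, eval_pow]
      exact mul_nonneg (by nlinarith) (mul_self_nonneg _))
  have h3 : ∫ s in α..β, (3 * h ^ 2 / 16) * (derivative p).eval s ^ 2 ≤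
      ∫ s in α..β, ((C h * X - X ^ 2) * (derivative p * derivative p)).eval s := by
    apply intervalIntegral.integral_mono_on hαβ
    · apply Continuous.intervalIntegrable
      exact continuous_const.mul ((derivative p).continuous.pow 2)
    · exact poly_ii _ _ _
    · intro s hs
      simp only [eval_mul, eval_sub, eval_X, eval_C, eval_pow, ← pow_two]
      apply mul_le_mul_of_nonneg_right _ (sq_nonneg _)
      nlinarith [mul_nonneg (by linarith [hs.1] : 0 ≤ s - h / 4) (by linarith [hs.2] : 0 ≤ 3 * h / 4 - s)]
  rw [intervalIntegral.integral_const_mul] at h3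
  have hM := ipI_sq_nonneg h hh p
  have h4 : (∫ s in α..β, (derivative p).eval s ^ 2) ≤ (n ^ 2 * ipI h (p * p)) / (3 * h ^ 2 / 16) := by
    rw [le_div_iff₀ (by positivity)]; linarith
  refine h4.trans ?_
  have : (7 * n / (3 * h)) ^ 2 * ipI h (p * p) - (n ^ 2 * ipI h (p * p)) / (3 * h ^ 2 / 16)
      = n ^ 2 * ipI h (p * p) / (9 * h ^ 2) := by field_simp; ring
  have : 0 ≤ n ^ 2 * ipI h (p * p) / (9 * h ^ 2) := by positivity
  linarith

theorem young_abs (x y μ : ℝ) (hμ : 0 < μ) : |x * y| ≤ 1 / 2 * (μ * x ^ 2 + y ^ 2 / μ) := by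
  have h1 : 0 ≤ (μ * |x| - |y|) ^ 2 / μ := by positivity
  have h2 : (μ * |x| - |y|) ^ 2 / μ = μ * x ^ 2 + y ^ 2 / μ - 2 * (|x| * |y|) := by
    rw [← sq_abs x, ← sq_abs y]; field_simp; ring
  rw [abs_mul]; linarith

theorem young_shift (F G : ℝ[X]) (α β σ μ : ℝ) (hαβ : α ≤ β) (hμ : 0 < μ) :
    |∫ s in α..β, F.eval s * G.eval (s + σ)| ≤
      1 / 2 * (μ * (∫ s in α..β, F.eval s ^ 2) + (∫ s in (α + σ)..(β + σ), G.eval s ^ 2) / μ) := by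
  have hF : Continuous fun s => F.eval s := F.continuous
  have hG : Continuous fun s => G.eval (s + σ) := G.continuous.comp (continuous_id.add continuous_const)
  calc _ ≤ ∫ s in α..β, |F.eval s * G.eval (s + σ)| :=
        intervalIntegral.abs_integral_le_integral_abs hαβ
    _ ≤ ∫ s in α..β, 1 / 2 * (μ * F.eval s ^ 2 + G.eval (s + σ) ^ 2 / μ) := by
        apply intervalIntegral.integral_mono_on hαβ
        · exact (hF.mul hG).abs.intervalIntegrable _ _
        · apply Continuous.intervalIntegrable
          exact continuous_const.mul ((continuous_const.mul (hF.pow 2)).add ((hG.pow 2).div_const _))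
        · intro s _; exact young_abs _ _ _ hμ
    _ = _ := by
        rw [intervalIntegral.integral_const_mul, intervalIntegral.integral_add,
          intervalIntegral.integral_const_mul, intervalIntegral.integral_div,
          intervalIntegral.integral_comp_add_right (fun s => G.eval s ^ 2)]
        · exact (continuous_const.mul (hF.pow 2)).intervalIntegrable _ _
        · exact ((hG.pow 2).div_const _).intervalIntegrable _ _

theorem ibp_shift (f g : ℝ[X]) (α β σ : ℝ) :
    ∫ s in α..β, (derivative f).eval s * g.eval (s + σ) =
      f.eval β * g.eval (β + σ) - f.eval α * g.eval (α + σ)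
        - ∫ s in α..β, f.eval s * (derivative g).eval (s + σ) := by
  have hg : ∀ q : ℝ[X], Continuous fun s => q.eval (s + σ) :=
    fun q => q.continuous.comp (continuous_id.add continuous_const)
  have := intervalIntegral.integral_deriv_mul_eq_sub (a := α) (b := β)
    (u := fun s => f.eval s) (v := fun s => g.eval (s + σ))
    (u' := fun s => (derivative f).eval s) (v' := fun s => (derivative g).eval (s + σ))
    (fun x _ => f.hasDerivAt x) (fun x _ => (g.hasDerivAt (x + σ)).comp_add_const x σ)
    (poly_ii _ _ _) ((hg _).intervalIntegrable _ _)
  rw [intervalIntegral.integral_add] at this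
  · linarith
  · exact ((derivative f).continuous.mul (hg g)).intervalIntegrable _ _
  · exact (f.continuous.mul (hg _)).intervalIntegrable _ _

theorem piece_left (h : ℝ) (hh : 0 < h) (a : ℕ) (ha : 1 ≤ a) (f g : ℝ[X])
    (hf : f.degree < (a : WithBot ℕ)) (α β σ t : ℝ) (ht : 0 < t)
    (hα : h / 4 ≤ α) (hαβ : α ≤ β) (hβ : β ≤ 3 * h / 4) (h1 : 0 ≤ α + σ) (h2 : β + σ ≤ h) :
    |∫ s in α..β, (derivative f).eval s * g.eval (s + σ)| ≤
      7 * a / (6 * h) * (t * ipI h (f * f) + ipI h (g * g) / t) := by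
  have ha' : (0:ℝ) < a := by exact_mod_cast ha
  have hμ : 0 < t / (7 * a / (3 * h)) := by positivity
  refine (young_shift (derivative f) g α β σ _ hαβ hμ).trans ?_
  have b1 := deriv_mid h hh a f hf α β hα hαβ hβ
  have b2 := sq_sub_le h g (α + σ) (β + σ) h1 (by linarith) h2
  calc _ ≤ 1 / 2 * (t / (7 * a / (3 * h)) * ((7 * a / (3 * h)) ^ 2 * ipI h (f * f))
        + ipI h (g * g) / (t / (7 * a / (3 * h)))) := by gcongr
    _ = _ := by field_simp; ring

theorem piece_right (h : ℝ) (hh : 0 < h) (b : ℕ) (hb : 1 ≤ b) (f g : ℝ[X])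
    (hg : g.degree < (b : WithBot ℕ)) (α β σ t : ℝ) (ht : 0 < t)
    (hα : 0 ≤ α) (hαβ : α ≤ β) (hβ : β ≤ h) (h1 : h / 4 ≤ α + σ) (h2 : β + σ ≤ 3 * h / 4) :
    |∫ s in α..β, f.eval s * (derivative g).eval (s + σ)| ≤
      7 * b / (6 * h) * (t * ipI h (f * f) + ipI h (g * g) / t) := by
  have hb' : (0:ℝ) < b := by exact_mod_cast hb
  have hμ : 0 < t * (7 * b / (3 * h)) := by positivity
  refine (young_shift f (derivative g) α β σ _ hαβ hμ).trans ?_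
  have b1 := deriv_mid h hh b g hg (α + σ) (β + σ) h1 (by linarith) h2
  have b2 := sq_sub_le h f α β hα hαβ hβ
  calc _ ≤ 1 / 2 * (t * (7 * b / (3 * h)) * ipI h (f * f)
        + ((7 * b / (3 * h)) ^ 2 * ipI h (g * g)) / (t * (7 * b / (3 * h)))) := by gcongr
    _ = _ := by field_simp; ring

theorem pt_aux (h : ℝ) (hh : 0 < h) (n : ℕ) (hn : 1 ≤ n) (p : ℝ[X]) (hp : p.degree < (n : WithBot ℕ))
    (x y : ℝ) (hx : ∀ s, h / 4 ≤ s → s ≤ 3 * h / 4 → |s - x| ≤ h / 2)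
    (hxy : ((X - C x) * (p * p)).eval (3 * h / 4) - ((X - C x) * (p * p)).eval (h / 4)
      = h / 2 * p.eval y ^ 2) :
    p.eval y ^ 2 ≤ 20 * n / (3 * h) * ipI h (p * p) := by
  have hn' : (1:ℝ) ≤ n := by exact_mod_cast hn
  have hle : h / 4 ≤ 3 * h / 4 := by linarith
  have e1 : ∫ s in (h/4)..(3 * h / 4), (derivative ((X - C x) * (p * p))).eval s = h / 2 * p.eval y ^ 2 := by
    rw [← hxy]
    exact intervalIntegral.integral_eq_sub_of_hasDerivAt (fun s _ => Polynomial.hasDerivAt _ s)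
      (poly_ii _ _ _)
  set κ : ℝ := 7 * n / (3 * h) with hκ
  have hκ0 : 0 < κ := by positivity
  have b1 := deriv_mid h hh n p hp (h/4) (3 * h / 4) le_rfl hle le_rfl
  have b2 := sq_sub_le h p (h/4) (3 * h / 4) (by linarith) hle (by linarith)
  have cp : Continuous fun s => p.eval s ^ 2 := p.continuous.pow 2
  have cp' : Continuous fun s => (derivative p).eval s ^ 2 := (derivative p).continuous.pow 2
  have e2 : ∫ s in (h/4)..(3 * h / 4), (derivative ((X - C x) * (p * p))).eval s ≤
      ∫ s in (h/4)..(3 * h / 4), ((1 + h / 2 * κ) * p.eval s ^ 2 + (h / 2 / κ) * (derivative p).eval s ^ 2) := by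
    apply intervalIntegral.integral_mono_on hle (poly_ii _ _ _)
    · exact ((continuous_const.mul cp).add (continuous_const.mul cp')).intervalIntegrable _ _
    · intro s hs
      have y1 := young_abs (p.eval s) ((derivative p).eval s) κ hκ0
      have y2 := hx s hs.1 hs.2
      have y3 : (s - x) * (p.eval s * (derivative p).eval s) ≤
          h / 2 * (1 / 2 * (κ * p.eval s ^ 2 + (derivative p).eval s ^ 2 / κ)) := by
        refine (le_abs_self _).trans ?_
        rw [abs_mul]
        exact mul_le_mul y2 y1 (abs_nonneg _) (by positivity)
      simp only [derivative_mul, derivative_sub, derivative_X, derivative_C, eval_add, eval_mul,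
        eval_sub, eval_X, eval_C, eval_one, eval_zero]
      have : h / 2 * (1 / 2 * (κ * p.eval s ^ 2 + (derivative p).eval s ^ 2 / κ)) * 2
        = h / 2 * κ * p.eval s ^ 2 + (h / 2 / κ) * (derivative p).eval s ^ 2 := by ring
      nlinarith
  have i1 : IntervalIntegrable (fun s => (1 + h / 2 * κ) * p.eval s ^ 2) MeasureTheory.volume (h/4) (3 * h / 4) :=
    (continuous_const.mul cp).intervalIntegrable _ _
  have i2 : IntervalIntegrable (fun s => (h / 2 / κ) * (derivative p).eval s ^ 2) MeasureTheory.volume (h/4) (3 * h / 4) :=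
    (continuous_const.mul cp').intervalIntegrable _ _
  rw [e1, intervalIntegral.integral_add i1 i2, intervalIntegral.integral_const_mul,
    intervalIntegral.integral_const_mul] at e2
  have hM := ipI_sq_nonneg h hh p
  have e3 : h / 2 * p.eval y ^ 2 ≤ (1 + h / 2 * κ) * ipI h (p * p) + (h / 2 / κ) * (κ ^ 2 * ipI h (p * p)) := by
    refine e2.trans ?_
    gcongr
  have e4 : (1 + h / 2 * κ) * ipI h (p * p) + (h / 2 / κ) * (κ ^ 2 * ipI h (p * p))
      = (1 + 7 * n / 3) * ipI h (p * p) := by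
    rw [hκ]; field_simp; ring
  rw [e4] at e3
  have e5 : (1 + 7 * n / 3) * ipI h (p * p) ≤ (10 * n / 3) * ipI h (p * p) := by
    apply mul_le_mul_of_nonneg_right _ hM; linarith
  have e6 : 20 * n / (3 * h) * ipI h (p * p) = ((10 * n / 3) * ipI h (p * p)) / (h / 2) := by
    field_simp; ring
  rw [e6, le_div_iff₀ (by positivity)]
  linarith

theorem pt_left (h : ℝ) (hh : 0 < h) (n : ℕ) (hn : 1 ≤ n) (p : ℝ[X]) (hp : p.degree < (n : WithBot ℕ)) :
    p.eval (h / 4) ^ 2 ≤ 20 * n / (3 * h) * ipI h (p * p) := by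
  apply pt_aux h hh n hn p hp (3 * h / 4)
  · intro s h1 h2; rw [abs_le]; constructor <;> linarith
  · simp only [eval_mul, eval_sub, eval_X, eval_C]; ring

theorem pt_right (h : ℝ) (hh : 0 < h) (n : ℕ) (hn : 1 ≤ n) (p : ℝ[X]) (hp : p.degree < (n : WithBot ℕ)) :
    p.eval (3 * h / 4) ^ 2 ≤ 20 * n / (3 * h) * ipI h (p * p) := by
  apply pt_aux h hh n hn p hp (h / 4)
  · intro s h1 h2; rw [abs_le]; constructor <;> linarith
  · simp only [eval_mul, eval_sub, eval_X, eval_C]; ring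

theorem pt_prod (h : ℝ) (hh : 0 < h) (a b : ℕ) (ha : 1 ≤ a) (hb : 1 ≤ b) (x y Mf Mg t : ℝ) (ht : 0 < t)
    (hx : x ^ 2 ≤ 20 * a / (3 * h) * Mf) (hy : y ^ 2 ≤ 20 * b / (3 * h) * Mg) :
    |x * y| ≤ 10 * Real.sqrt (a * b) / (3 * h) * (t * Mf + Mg / t) := by
  have ha' : (0:ℝ) < a := by exact_mod_cast ha
  have hb' : (0:ℝ) < b := by exact_mod_cast hb
  rw [Real.sqrt_mul ha'.le]
  have hA : (0:ℝ) < √a := Real.sqrt_pos.2 ha'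
  have hB : (0:ℝ) < √b := Real.sqrt_pos.2 hb'
  have eA : (a:ℝ) = √a ^ 2 := (Real.sq_sqrt ha'.le).symm
  have eB : (b:ℝ) = √b ^ 2 := (Real.sq_sqrt hb'.le).symm
  generalize √(a:ℝ) = A at *
  generalize √(b:ℝ) = B at *
  rw [eA] at hx
  rw [eB] at hy
  refine (young_abs x y (t * B / A) (by positivity)).trans ?_
  calc _ ≤ 1 / 2 * (t * B / A * (20 * A ^ 2 / (3 * h) * Mf) + (20 * B ^ 2 / (3 * h) * Mg) / (t * B / A)) := by
        gcongr
    _ = _ := by field_simp; ring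

noncomputable def Cst (a b : ℕ) : ℝ := 7 / 3 * ((a:ℝ) + b) + 20 / 3 * Real.sqrt (a * b)

theorem half_left (h : ℝ) (hh : 0 < h) (a b : ℕ) (ha : 1 ≤ a) (hb : 1 ≤ b) (f g : ℝ[X])
    (hf : f.degree < (a : WithBot ℕ)) (hg : g.degree < (b : WithBot ℕ)) (t : ℝ) (ht : 0 < t) :
    -((∫ s in (0:ℝ)..(h / 2), (derivative f).eval s * g.eval (s + h / 2)) + f.eval 0 * g.eval (h / 2))
      ≤ Cst a b / (2 * h) * (t * ipI h (f * f) + ipI h (g * g) / t) := by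
  have hc : Continuous fun s => (derivative f).eval s * g.eval (s + h / 2) :=
    (derivative f).continuous.mul (g.continuous.comp (continuous_id.add continuous_const))
  rw [← intervalIntegral.integral_add_adjacent_intervals (hc.intervalIntegrable 0 (h / 4))
    (hc.intervalIntegrable (h / 4) (h / 2)), ibp_shift f g 0 (h / 4)]
  have e1 : h / 4 + h / 2 = 3 * h / 4 := by ring
  rw [e1, zero_add]
  have p1 := piece_left h hh a ha f g hf (h / 4) (h / 2) (h / 2) t ht le_rfl (by linarith) (by linarith)
    (by linarith) (by linarith)
  have p2 := piece_right h hh b hb f g hg 0 (h / 4) (h / 2) t ht le_rfl (by linarith) (by linarith)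
    (by linarith) (by linarith)
  have p3 := pt_prod h hh a b ha hb _ _ _ _ t ht (pt_left h hh a ha f hf) (pt_right h hh b hb g hg)
  have e2 : Cst a b / (2 * h) * (t * ipI h (f * f) + ipI h (g * g) / t) =
      7 * a / (6 * h) * (t * ipI h (f * f) + ipI h (g * g) / t)
      + 7 * b / (6 * h) * (t * ipI h (f * f) + ipI h (g * g) / t)
      + 10 * Real.sqrt (a * b) / (3 * h) * (t * ipI h (f * f) + ipI h (g * g) / t) := by
    unfold Cst; field_simp; ring
  rw [e2]
  have q1 := (abs_le.1 p1).1
  have q2 := (abs_le.1 p2).2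
  have q3 := (abs_le.1 p3).1
  linarith

theorem half_right (h : ℝ) (hh : 0 < h) (a b : ℕ) (ha : 1 ≤ a) (hb : 1 ≤ b) (f g : ℝ[X])
    (hf : f.degree < (a : WithBot ℕ)) (hg : g.degree < (b : WithBot ℕ)) (t : ℝ) (ht : 0 < t) :
    -((∫ s in (h / 2)..h, (derivative f).eval s * g.eval (s - h / 2)) - f.eval h * g.eval (h / 2))
      ≤ Cst a b / (2 * h) * (t * ipI h (f * f) + ipI h (g * g) / t) := by
  simp only [sub_eq_add_neg _ (h / 2)]
  have hc : Continuous fun s => (derivative f).eval s * g.eval (s + -(h / 2)) :=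
    (derivative f).continuous.mul (g.continuous.comp (continuous_id.add continuous_const))
  rw [← intervalIntegral.integral_add_adjacent_intervals (hc.intervalIntegrable (h / 2) (3 * h / 4))
    (hc.intervalIntegrable (3 * h / 4) h), ibp_shift f g (3 * h / 4) h]
  have e1 : 3 * h / 4 + -(h / 2) = h / 4 := by ring
  have e0 : h + -(h / 2) = h / 2 := by ring
  rw [e1, e0]
  have p1 := piece_left h hh a ha f g hf (h / 2) (3 * h / 4) (-(h / 2)) t ht (by linarith) (by linarith) (by linarith)
    (by linarith) (by linarith)
  have p2 := piece_right h hh b hb f g hg (3 * h / 4) h (-(h / 2)) t ht (by linarith) (by linarith) (by linarith)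
    (by linarith) (by linarith)
  have p3 := pt_prod h hh a b ha hb _ _ _ _ t ht (pt_right h hh a ha f hf) (pt_left h hh b hb g hg)
  have e2 : Cst a b / (2 * h) * (t * ipI h (f * f) + ipI h (g * g) / t) =
      7 * a / (6 * h) * (t * ipI h (f * f) + ipI h (g * g) / t)
      + 7 * b / (6 * h) * (t * ipI h (f * f) + ipI h (g * g) / t)
      + 10 * Real.sqrt (a * b) / (3 * h) * (t * ipI h (f * f) + ipI h (g * g) / t) := by
    unfold Cst; field_simp; ring
  rw [e2]
  have q1 := (abs_le.1 p1).1
  have q2 := (abs_le.1 p2).2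
  have q3 := (abs_le.1 p3).2
  linarith

theorem tr_prod (h : ℝ) (hh : 0 < h) (a : ℕ) (x y Mf Mg t : ℝ) (ht : 0 < t)
    (hx : h * x ^ 2 ≤ a ^ 2 * Mf) (hy : h * y ^ 2 ≤ a ^ 2 * Mg) :
    |x * y| ≤ a ^ 2 / (2 * h) * (t * Mf + Mg / t) := by
  refine (young_abs x y t ht).trans ?_
  have hx' : x ^ 2 ≤ a ^ 2 * Mf / h := by rw [le_div_iff₀ hh]; linarith
  have hy' : y ^ 2 ≤ a ^ 2 * Mg / h := by rw [le_div_iff₀ hh]; linarith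
  calc _ ≤ 1 / 2 * (t * (a ^ 2 * Mf / h) + (a ^ 2 * Mg / h) / t) := by gcongr
    _ = _ := by field_simp

theorem opt_bound (B k X Y : ℝ) (hk : 0 ≤ k) (hX : 0 ≤ X) (hY : 0 ≤ Y)
    (hB : ∀ s : ℝ, 0 < s → B ≤ k * (s * Y + X / s)) : B ≤ 2 * k * √X * √Y := by
  rcases hX.eq_or_lt with h0 | hX'
  · subst h0
    simp only [Real.sqrt_zero, mul_zero, zero_mul]
    by_contra hpos
    push Not at hpos
    have hkY := mul_nonneg hk hY
    have := hB (B / (2 * (k * Y + 1))) (by positivity)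
    have e : k * (B / (2 * (k * Y + 1)) * Y + 0 / (B / (2 * (k * Y + 1)))) = B * (k * Y / (2 * (k * Y + 1))) := by
      rw [zero_div]; field_simp; ring
    have : k * Y / (2 * (k * Y + 1)) < 1 := by rw [div_lt_one (by positivity)]; linarith
    nlinarith
  rcases hY.eq_or_lt with h0 | hY'
  · subst h0
    simp only [Real.sqrt_zero, mul_zero]
    by_contra hpos
    push Not at hpos
    have hkY := mul_nonneg hk hX
    have := hB ((2 * (k * X + 1)) / B) (by positivity)
    have e : k * ((2 * (k * X + 1)) / B * 0 + X / ((2 * (k * X + 1)) / B)) = B * (k * X / (2 * (k * X + 1))) := by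
      field_simp; ring
    have : k * X / (2 * (k * X + 1)) < 1 := by rw [div_lt_one (by positivity)]; linarith
    nlinarith
  have hA : 0 < √X := Real.sqrt_pos.2 hX'
  have hD : 0 < √Y := Real.sqrt_pos.2 hY'
  have eA : X = √X ^ 2 := (Real.sq_sqrt hX).symm
  have eD : Y = √Y ^ 2 := (Real.sq_sqrt hY).symm
  have := hB (√X / √Y) (by positivity)
  refine this.trans (le_of_eq ?_)
  generalize √X = A at *
  generalize √Y = D at *
  rw [eA, eD]; field_simp; ring

theorem deg_lt (p : ℝ[X]) (n : ℕ) (hn : 1 ≤ n) (hp : p.natDegree ≤ n - 1) :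
    p.degree < (n : WithBot ℕ) := by
  refine lt_of_le_of_lt degree_le_natDegree ?_
  exact_mod_cast (by omega : p.natDegree < n)

theorem brokenNormSq_eq (N : ℕ) [NeZero N] (h : ℝ) (p : ZMod N → ℝ[X]) :
    brokenNormSq N h p = ∑ j, ipI h (p j * p j) := by
  unfold brokenNormSq ipI
  simp only [eval_mul, ← pow_two (eval _ _)]

theorem brokenNormSq_nonneg (N : ℕ) [NeZero N] (h : ℝ) (hh : 0 < h) (p : ZMod N → ℝ[X]) :
    0 ≤ brokenNormSq N h p := by
  rw [brokenNormSq_eq]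
  exact Finset.sum_nonneg (fun j _ => ipI_sq_nonneg h hh _)

theorem sum_shift_add (N : ℕ) [NeZero N] (F : ZMod N → ℝ) : ∑ j, F (j + 1) = ∑ j, F j :=
  Equiv.sum_comp (Equiv.addRight (1 : ZMod N)) F

theorem sum_shift_sub (N : ℕ) [NeZero N] (F : ZMod N → ℝ) : ∑ j, F (j - 1) = ∑ j, F j :=
  Equiv.sum_comp (Equiv.subRight (1 : ZMod N)) F

theorem Cst_comm (a b : ℕ) : Cst a b = Cst b a := by
  unfold Cst; rw [add_comm, mul_comm (a:ℝ) b, add_comm (a:ℝ)]; ring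

theorem loc_bound (h : ℝ) (hh : 0 < h) (a b : ℕ) (ha : 1 ≤ a) (hb : 1 ≤ b) (f g1 g2 p1 p2 p3 p4 : ℝ[X])
    (hf : f.degree < (a : WithBot ℕ)) (hg1 : g1.degree < (b : WithBot ℕ))
    (hg2 : g2.degree < (b : WithBot ℕ)) (hp1 : p1.degree < (a : WithBot ℕ))
    (hp2 : p2.degree < (a : WithBot ℕ)) (hp3 : p3.degree < (a : WithBot ℕ))
    (hp4 : p4.degree < (a : WithBot ℕ)) (t s : ℝ) (ht : 0 < t) (hs : 0 < s) (κ : ℝ) (hκ : 0 ≤ κ) :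
    -((∫ s in (0:ℝ)..(h / 2), (derivative f).eval s * g1.eval (s + h / 2))
        + (∫ s in (h / 2)..h, (derivative f).eval s * g2.eval (s - h / 2))
        - f.eval h * (g2.eval (h / 2) - κ * (p1.eval h - p2.eval 0))
        + f.eval 0 * (g1.eval (h / 2) - κ * (p3.eval h - p4.eval 0)))
    ≤ Cst a b / (2 * h) * (2 * t * ipI h (f * f) + (ipI h (g1 * g1) + ipI h (g2 * g2)) / t)
      + κ * (a ^ 2 / (2 * h)) * (4 * s * ipI h (f * f) + (ipI h (p1 * p1) + ipI h (p2 * p2)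
        + ipI h (p3 * p3) + ipI h (p4 * p4)) / s) := by
  have q1 := half_left h hh a b ha hb f g1 hf hg1 t ht
  have q2 := half_right h hh a b ha hb f g2 hf hg2 t ht
  have fr := trace_right h hh a f hf
  have fl := trace_left h hh a f hf
  have r1 := (abs_le.1 (tr_prod h hh a _ _ _ _ s hs fr (trace_right h hh a p1 hp1))).1
  have r2 := (abs_le.1 (tr_prod h hh a _ _ _ _ s hs fr (trace_left h hh a p2 hp2))).2
  have r3 := (abs_le.1 (tr_prod h hh a _ _ _ _ s hs fl (trace_right h hh a p3 hp3))).2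
  have r4 := (abs_le.1 (tr_prod h hh a _ _ _ _ s hs fl (trace_left h hh a p4 hp4))).1
  have r : -(f.eval h * p1.eval h) + f.eval h * p2.eval 0 + f.eval 0 * p3.eval h - f.eval 0 * p4.eval 0
      ≤ (a ^ 2 / (2 * h)) * (4 * s * ipI h (f * f) + (ipI h (p1 * p1) + ipI h (p2 * p2)
        + ipI h (p3 * p3) + ipI h (p4 * p4)) / s) := by
    have e : (a ^ 2 / (2 * h)) * (4 * s * ipI h (f * f) + (ipI h (p1 * p1) + ipI h (p2 * p2)
        + ipI h (p3 * p3) + ipI h (p4 * p4)) / s) =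
      a ^ 2 / (2 * h) * (s * ipI h (f * f) + ipI h (p1 * p1) / s)
      + a ^ 2 / (2 * h) * (s * ipI h (f * f) + ipI h (p2 * p2) / s)
      + a ^ 2 / (2 * h) * (s * ipI h (f * f) + ipI h (p3 * p3) / s)
      + a ^ 2 / (2 * h) * (s * ipI h (f * f) + ipI h (p4 * p4) / s) := by ring
    rw [e]; linarith
  have r' := mul_le_mul_of_nonneg_left r hκ
  have e : Cst a b / (2 * h) * (2 * t * ipI h (f * f) + (ipI h (g1 * g1) + ipI h (g2 * g2)) / t) =
    Cst a b / (2 * h) * (t * ipI h (f * f) + ipI h (g1 * g1) / t)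
    + Cst a b / (2 * h) * (t * ipI h (f * f) + ipI h (g2 * g2) / t) := by ring
  rw [e, mul_assoc κ]
  nlinarith

theorem const_bound (qu qv : ℕ) (hqu : 1 ≤ qu) :
    2 * Cst qu (qv + 1) ≤ (8 * Real.sqrt 3 + 4) / 3 * ((qu : ℝ) + (qv : ℝ) - 1)
          + 128 / (Real.sqrt 3 * Real.pi) * Real.sqrt ((qu : ℝ) * ((qv : ℝ) + 1)) := by
  have ha : (1:ℝ) ≤ qu := by exact_mod_cast hqu
  have hb : (0:ℝ) ≤ qv := Nat.cast_nonneg _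
  have hr : 1 ≤ Real.sqrt ((qu : ℝ) * ((qv : ℝ) + 1)) := by
    rw [Real.one_le_sqrt]; nlinarith
  have h3 : (3/2:ℝ) ≤ √3 := by
    rw [Real.le_sqrt (by norm_num) (by norm_num)]; norm_num
  have h3' : √3 ≤ (7/4:ℝ) := by
    rw [Real.sqrt_le_left (by norm_num)]; norm_num
  have hpi := Real.pi_lt_d2
  have hpi0 := Real.pi_pos
  have hD : (23:ℝ) ≤ 128 / (√3 * Real.pi) := by
    rw [le_div_iff₀ (by positivity)]
    nlinarith
  have h1 : 14 / 3 * ((qu : ℝ) + (qv : ℝ) - 1) ≤ (8 * Real.sqrt 3 + 4) / 3 * ((qu : ℝ) + (qv : ℝ) - 1) :=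
    mul_le_mul_of_nonneg_right (by linarith) (by linarith)
  have h2 := mul_le_mul_of_nonneg_right hD (Real.sqrt_nonneg ((qu : ℝ) * ((qv : ℝ) + 1)))
  unfold Cst
  push_cast
  linarith

/-- Theorem 2, order-scaled upwind case: with `β = β̂/(q_u c)` and `τ = c τ̂/(q_v+1)`
the staggered DG operator bound grows only linearly in the polynomial degrees. -/
theorem staggered_operator_bound_order_scaled_upwind
    (N : ℕ) [NeZero N] (hN : 1 ≤ N) (h c : ℝ) (hh : 0 < h) (hc : 0 < c)
    (qu qv : ℕ) (hqu : 1 ≤ qu) (β τ βhat τhat : ℝ)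
    (hβhat : 0 ≤ βhat) (hτhat : 0 ≤ τhat)
    (hβ : β = βhat / ((qu : ℝ) * c)) (hτ : τ = c * τhat / ((qv : ℝ) + 1))
    (w φ v ψ : ZMod N → Polynomial ℝ)
    (hw : ∀ j, (w j).natDegree ≤ qu - 1) (hφ : ∀ j, (φ j).natDegree ≤ qu - 1)
    (hv : ∀ j, (v j).natDegree ≤ qv) (hψ : ∀ j, (ψ j).natDegree ≤ qv) :
    BformS N h c β τ w v φ ψ ≤
      c / h * ((8 * Real.sqrt 3 + 4) / 3 * ((qu : ℝ) + (qv : ℝ) - 1)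
          + 128 / (Real.sqrt 3 * Real.pi) * Real.sqrt ((qu : ℝ) * ((qv : ℝ) + 1))
          + 4 * max (βhat * (qu : ℝ)) (τhat * ((qv : ℝ) + 1)))
        * Real.sqrt (c ^ 2 * brokenNormSq N h w + brokenNormSq N h v)
        * Real.sqrt (c ^ 2 * brokenNormSq N h φ + brokenNormSq N h ψ) := by
  have ha : (1:ℝ) ≤ qu := by exact_mod_cast hqu
  have hb : (0:ℝ) < (qv:ℝ) + 1 := by positivity
  have dw : ∀ j, (w j).degree < (qu : WithBot ℕ) := fun j => deg_lt _ _ hqu (hw j)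
  have dφ : ∀ j, (φ j).degree < (qu : WithBot ℕ) := fun j => deg_lt _ _ hqu (hφ j)
  have dv : ∀ j, (v j).degree < ((qv + 1 : ℕ) : WithBot ℕ) := fun j => deg_lt _ _ (by omega) (by simpa using hv j)
  have dψ : ∀ j, (ψ j).degree < ((qv + 1 : ℕ) : WithBot ℕ) := fun j => deg_lt _ _ (by omega) (by simpa using hψ j)
  have hW := brokenNormSq_nonneg N h hh w
  have hΦ := brokenNormSq_nonneg N h hh φ
  have hV := brokenNormSq_nonneg N h hh v
  have hΨ := brokenNormSq_nonneg N h hh ψ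
  have hC : 0 ≤ Cst qu (qv + 1) := by unfold Cst; positivity
  set m := max (βhat * (qu : ℝ)) (τhat * ((qv : ℝ) + 1)) with hm
  have hm1 : βhat * (qu : ℝ) ≤ m := le_max_left _ _
  have hm2 : τhat * ((qv : ℝ) + 1) ≤ m := le_max_right _ _
  have hm0 : 0 ≤ m := le_trans (by positivity) hm1
  have main : BformS N h c β τ w v φ ψ ≤ 2 * (c / h * (Cst qu (qv + 1) + 2 * m))
      * Real.sqrt (c ^ 2 * brokenNormSq N h w + brokenNormSq N h v)
      * Real.sqrt (c ^ 2 * brokenNormSq N h φ + brokenNormSq N h ψ) := by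
    apply opt_bound _ _ _ _ (by positivity) (by positivity) (by positivity)
    intro s hs
    have hκ1 : 0 ≤ β * c ^ 2 := by rw [hβ]; positivity
    have hκ2 : 0 ≤ τ / c ^ 2 := by rw [hτ]; positivity
    have S1 := Finset.sum_le_sum (fun j (_ : j ∈ (Finset.univ : Finset (ZMod N))) =>
      loc_bound h hh qu (qv + 1) hqu (by omega) (φ j) (v j) (v (j + 1)) (w (j + 1 - 1)) (w (j + 1))
        (w (j - 1)) (w j) (dφ _) (dv _) (dv _) (dw _) (dw _) (dw _) (dw _) (s * c) s (by positivity) hs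
        (β * c ^ 2) hκ1)
    have S2 := Finset.sum_le_sum (fun j (_ : j ∈ (Finset.univ : Finset (ZMod N))) =>
      loc_bound h hh (qv + 1) qu (by omega) hqu (ψ j) (w (j - 1)) (w j) (v j) (v (j + 1))
        (v (j - 1)) (v (j - 1 + 1)) (dψ _) (dw _) (dw _) (dv _) (dv _) (dv _) (dv _) (s / c) s
        (by positivity) hs (τ / c ^ 2) hκ2)
    rw [Finset.sum_neg_distrib] at S1 S2
    simp only [add_sub_cancel_right, sub_add_cancel, Finset.sum_add_distrib, ← Finset.mul_sum,
      ← Finset.sum_div, sum_shift_add N (fun j => ipI h (v j * v j)),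
      sum_shift_add N (fun j => ipI h (w j * w j)), sum_shift_sub N (fun j => ipI h (v j * v j)),
      sum_shift_sub N (fun j => ipI h (w j * w j)), ← brokenNormSq_eq] at S1 S2
    rw [Cst_comm] at S2
    have hBf : BformS N h c β τ w v φ ψ = c ^ 2 * (-(∑ j : ZMod N,
      ((∫ s in (0:ℝ)..(h / 2), (derivative (φ j)).eval s * (v j).eval (s + h / 2))
        + (∫ s in (h / 2)..h, (derivative (φ j)).eval s * (v (j + 1)).eval (s - h / 2))
        - (φ j).eval h * ((v (j + 1)).eval (h / 2) - β * c ^ 2 * ((w j).eval h - (w (j + 1)).eval 0))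
        + (φ j).eval 0 * ((v j).eval (h / 2) - β * c ^ 2 * ((w (j - 1)).eval h - (w j).eval 0)))))
      + c ^ 2 * (-(∑ j : ZMod N,
      ((∫ s in (0:ℝ)..(h / 2), (derivative (ψ j)).eval s * (w (j - 1)).eval (s + h / 2))
        + (∫ s in (h / 2)..h, (derivative (ψ j)).eval s * (w j).eval (s - h / 2))
        - (ψ j).eval h * ((w j).eval (h / 2) - τ / c ^ 2 * ((v j).eval h - (v (j + 1)).eval 0))
        + (ψ j).eval 0 * ((w (j - 1)).eval (h / 2) - τ / c ^ 2 * ((v (j - 1)).eval h - (v j).eval 0))))) := by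
      unfold BformS HfluxS GfluxS
      simp only [add_sub_cancel_right, sub_add_cancel]
      ring
    have T1 := mul_le_mul_of_nonneg_left S1 (sq_nonneg c)
    have T2 := mul_le_mul_of_nonneg_left S2 (sq_nonneg c)
    simp only [Finset.sum_add_distrib, Finset.sum_sub_distrib] at hBf T1 T2
    generalize brokenNormSq N h w = W at *
    generalize brokenNormSq N h φ = Φ at *
    generalize brokenNormSq N h v = V at *
    generalize brokenNormSq N h ψ = Ψ at *
    generalize Cst qu (qv + 1) = K at *
    have G1 : βhat * qu * (s * (c ^ 2 * Φ) + c ^ 2 * W / s) ≤ m * (s * (c ^ 2 * Φ) + c ^ 2 * W / s) :=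
      mul_le_mul_of_nonneg_right hm1 (by positivity)
    have G2 : τhat * (qv + 1) * (s * Ψ + V / s) ≤ m * (s * Ψ + V / s) :=
      mul_le_mul_of_nonneg_right hm2 (by positivity)
    have G3 : c / h * K * (s * (c ^ 2 * Φ) + V / s) + c / h * K * (s * Ψ + c ^ 2 * W / s)
        + 2 * (c / h) * (βhat * qu * (s * (c ^ 2 * Φ) + c ^ 2 * W / s))
        + 2 * (c / h) * (τhat * (qv + 1) * (s * Ψ + V / s)) ≤
        c / h * (K + 2 * m) * (s * (c ^ 2 * Φ + Ψ) + (c ^ 2 * W + V) / s) := by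
      have g1 := mul_le_mul_of_nonneg_left G1 (by positivity : 0 ≤ 2 * (c / h))
      have g2 := mul_le_mul_of_nonneg_left G2 (by positivity : 0 ≤ 2 * (c / h))
      calc _ ≤ c / h * K * (s * (c ^ 2 * Φ) + V / s) + c / h * K * (s * Ψ + c ^ 2 * W / s)
          + 2 * (c / h) * (m * (s * (c ^ 2 * Φ) + c ^ 2 * W / s))
          + 2 * (c / h) * (m * (s * Ψ + V / s)) := by linarith
        _ = _ := by ring
    refine le_trans ?_ G3
    rw [hBf]
    refine (add_le_add T1 T2).trans (le_of_eq ?_)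
    rw [hβ, hτ]
    push_cast
    have hq : (qu:ℝ) ≠ 0 := by positivity
    field_simp
    ring
  refine main.trans ?_
  apply mul_le_mul_of_nonneg_right _ (Real.sqrt_nonneg _)
  apply mul_le_mul_of_nonneg_right _ (Real.sqrt_nonneg _)
  have := mul_le_mul_of_nonneg_left (const_bound qu qv hqu) (by positivity : 0 ≤ c / h)
  calc _ = c / h * (2 * Cst qu (qv + 1)) + c / h * (4 * m) := by ring
    _ ≤ _ := by rw [mul_add (c / h)]; linarith
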